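/- For any two $k$-element subsets $I, J \subseteq \{1,\dots,n\}$, one has $\partial_I \partial_J P = (v_I, v_J)$; the left-hand side is the constant polynomial with value $a_{|I\cap J|} = (-1)^{k+|I\cap J|}\,(n-2k+1)\,(k-|I\cap J|)!\,(n-2k+|I\cap J|)!/(n-k+1)!$, which equals the Shapovalov pairing $(v_I,v_J)$ of the projected vectors. -/

import Mathlib

noncomputable section

/-- The `sl₂`-module `W^{⊗n}`, `W = ℂ²`, identified with the free complex vector space
on the set of subsets of `{1,…,n}`. -/
abbrev WT (n : ℕ) := Finset (Fin n) →₀ ℂ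

/-- Build a linear operator on `WT n` from its values on the basis vectors `V_I`. -/
def mkOp {n : ℕ} (φ : Finset (Fin n) → WT n) : WT n →ₗ[ℂ] WT n :=
  Finsupp.lsum ℂ fun I => LinearMap.toSpanSingleton ℂ (WT n) (φ I)

/-- Diagonal action of `e`: `e V_I = ∑_{i ∈ I} V_{I∖{i}}`. -/
def opE (n : ℕ) : WT n →ₗ[ℂ] WT n :=
  mkOp fun I => ∑ i ∈ I, Finsupp.single (I.erase i) 1

/-- Diagonal action of `f`: `f V_I = ∑_{i ∉ I} V_{I∪{i}}`. -/
def opF (n : ℕ) : WT n →ₗ[ℂ] WT n :=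
  mkOp fun I => ∑ i ∈ Iᶜ, Finsupp.single (insert i I) 1

/-- Diagonal action of `h`: `h V_I = (n - 2|I|) V_I`. -/
def opH (n : ℕ) : WT n →ₗ[ℂ] WT n :=
  mkOp fun I => ((n : ℂ) - 2 * I.card) • Finsupp.single I 1

/-- The Shapovalov form: the symmetric bilinear form with `(V_I, V_J) = δ_{IJ}`. -/
def shap {n : ℕ} (x y : WT n) : ℂ := x.sum fun I c => c * y I

/-- The weight space `W^{⊗n}[n-2k]`, spanned by the `V_I` with `|I| = k`. -/
def weight (n k : ℕ) : Submodule ℂ (WT n) :=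
  Submodule.span ℂ {x | ∃ I : Finset (Fin n), I.card = k ∧ x = Finsupp.single I 1}

/-- The space of singular vectors `Sing W^{⊗n}[n-2k] = {w ∈ W^{⊗n}[n-2k] : e w = 0}`. -/
def sing (n k : ℕ) : Submodule ℂ (WT n) :=
  weight n k ⊓ LinearMap.ker (opE n)

/-- `b_ℓ = (-1)^{k-ℓ} (k-ℓ-1)! (n-2k+ℓ+1)! / (n-k+1)!`. -/
def bCoef (n k ℓ : ℕ) : ℂ :=
  (-1) ^ (k - ℓ) * ((k - ℓ - 1).factorial : ℂ) * ((n - 2 * k + ℓ + 1).factorial : ℂ) /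
    ((n - k + 1).factorial : ℂ)

/-- `a_ℓ = (-1)^{k+ℓ} (n-2k+1) (k-ℓ)! (n-2k+ℓ)! / (n-k+1)!`. -/
def aCoef (n k ℓ : ℕ) : ℂ :=
  (-1) ^ (k + ℓ) * ((n - 2 * k + 1 : ℕ) : ℂ) * ((k - ℓ).factorial : ℂ) *
    ((n - 2 * k + ℓ).factorial : ℂ) / ((n - k + 1).factorial : ℂ)

/-- The set `𝒜` of sequences `α = ({p₁,q₁},…,{p_k,q_k})` of `k` pairwise disjoint
unordered two-element subsets of `{1,…,n}`, encoded as `k`-tuples of ordered pairs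
`(p_i, q_i)` with `p_i < q_i` whose underlying two-element sets are pairwise disjoint. -/
def pairSeqs (n k : ℕ) : Finset (Fin k → Fin n × Fin n) :=
  Finset.univ.filter fun α =>
    (∀ i, (α i).1 < (α i).2) ∧
    ∀ i j, i ≠ j →
      Disjoint ({(α i).1, (α i).2} : Finset (Fin n)) {(α j).1, (α j).2}

/-- Polynomials in the `nk` variables `z_i^{(j)}`, `i = 1,…,n`, `j = 1,…,k`;
the variable `z_i^{(j)}` is indexed by `(i, j) : Fin n × Fin k`. -/
abbrev PZ (n k : ℕ) := MvPolynomial (Fin n × Fin k) ℂ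

/-- The constant `c₁ = (n-2k+1)! / (2^k k! (n-k+1)!)`. -/
def c1 (n k : ℕ) : ℂ :=
  ((n - 2 * k + 1).factorial : ℂ) /
    (2 ^ k * (k.factorial : ℂ) * ((n - k + 1).factorial : ℂ))

/-- The potential of the first kind
`P = c₁ ∑_{α ∈ 𝒜} ∏_{i=1}^k (z_{p_i}^{(i)} - z_{q_i}^{(i)})²`. -/
def Ppoly (n k : ℕ) : PZ n k :=
  MvPolynomial.C (c1 n k) *
    ∑ α ∈ pairSeqs n k, ∏ i : Fin k,
      (MvPolynomial.X ((α i).1, i) - MvPolynomial.X ((α i).2, i)) ^ 2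

/-- Iterated formal partial derivative `∂/∂z_{g(1)}^{(1)} ⋯ ∂/∂z_{g(k)}^{(k)}`. -/
def derSeq {n k : ℕ} (g : Fin k → Fin n) (p : PZ n k) : PZ n k :=
  (List.finRange k).foldl (fun q j => MvPolynomial.pderiv (g j, j) q) p

/-- The differential operator
`∂_I = ∑_{σ ∈ S_k} ∂^k / ∂z_{i_{σ(1)}}^{(1)} ⋯ ∂z_{i_{σ(k)}}^{(k)}`, realized as the sum
over all bijections `g` from `{1,…,k}` onto the `k`-element subset `I`. -/
def pderI {n k : ℕ} (I : Finset (Fin n)) (p : PZ n k) : PZ n k :=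
  ∑ g ∈ Finset.univ.filter
      (fun g : Fin k → Fin n => Function.Injective g ∧ ∀ j, g j ∈ I),
    derSeq g p

open Finset

lemma shap_eq_sum {n : ℕ} (x y : WT n) : shap x y = ∑ I, x I * y I :=
  Finsupp.sum_fintype _ _ fun _ => zero_mul _

lemma shap_comm {n : ℕ} (x y : WT n) : shap x y = shap y x := by
  simp only [shap_eq_sum, mul_comm]

lemma shap_sub_left {n : ℕ} (x y s : WT n) : shap (x - y) s = shap x s - shap y s := by
  simp only [shap_eq_sum, Finsupp.sub_apply, sub_mul, sum_sub_distrib]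

lemma shap_single_left {n : ℕ} (I : Finset (Fin n)) (s : WT n) :
    shap (Finsupp.single I 1) s = s I := by
  simp [shap]

lemma mkOp_single {n : ℕ} (φ : Finset (Fin n) → WT n) (I : Finset (Fin n)) (c : ℂ) :
    mkOp φ (Finsupp.single I c) = c • φ I := by
  simp [mkOp]

lemma opE_apply {n : ℕ} (x : WT n) (K : Finset (Fin n)) :
    opE n x K = ∑ j ∈ Kᶜ, x (insert j K) := by
  induction x using Finsupp.induction_linear with
  | zero => simp
  | add x y hx hy => simp only [map_add, Finsupp.add_apply, hx, hy, sum_add_distrib]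
  | single L c =>
    rw [opE, mkOp_single, Finsupp.smul_apply, Finsupp.finsetSum_apply, smul_eq_mul, mul_sum,
      ← sum_filter_add_sum_filter_not Kᶜ (fun j => insert j K = L),
      ← sum_filter_add_sum_filter_not L (fun i => L.erase i = K)]
    have hset : L.filter (fun i => L.erase i = K) = Kᶜ.filter (fun j => insert j K = L) := by
      ext i
      simp only [mem_filter, mem_compl]
      constructor
      · rintro ⟨hi, rfl⟩
        exact ⟨notMem_erase i L, insert_erase hi⟩
      · rintro ⟨hi, rfl⟩
        exact ⟨mem_insert_self i K, erase_insert hi⟩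
    rw [hset]
    congr 1
    · refine sum_congr rfl fun i hi => ?_
      obtain ⟨hi', rfl⟩ := mem_filter.1 hi
      simp [erase_insert (mem_compl.1 hi')]
    · rw [sum_eq_zero, sum_eq_zero]
      · intro i hi
        exact Finsupp.single_eq_of_ne (mem_filter.1 hi).2
      · intro i hi
        rw [Finsupp.single_eq_of_ne' (mem_filter.1 hi).2, mul_zero]

lemma shap_opF {n : ℕ} (u s : WT n) : shap (opF n u) s = shap u (opE n s) := by
  induction u using Finsupp.induction_linear with
  | zero => simp [shap]
  | add x y hx hy =>
    simp only [shap_eq_sum, map_add, Finsupp.add_apply, add_mul, sum_add_distrib] at hx hy ⊢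
    rw [hx, hy]
  | single K c =>
    have hr : shap (Finsupp.single K c) (opE n s) = c * opE n s K := by simp [shap]
    rw [hr, opE_apply, opF, mkOp_single, shap_eq_sum]
    simp only [Finsupp.smul_apply, Finsupp.finsetSum_apply, smul_eq_mul, mul_assoc, ← mul_sum,
      sum_mul]
    rw [sum_comm]
    congr 1
    refine sum_congr rfl fun i _ => ?_
    simp [Finsupp.single_apply]

lemma opF_apply {n : ℕ} (u : WT n) (J : Finset (Fin n)) :
    opF n u J = ∑ j ∈ J, u (J.erase j) := by
  have h := shap_opF u (Finsupp.single J 1)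
  rw [shap_comm, shap_single_left] at h
  rw [h, shap_comm, opE, mkOp_single, one_smul, shap_eq_sum]
  simp only [Finsupp.finsetSum_apply, sum_mul]
  rw [sum_comm]
  refine sum_congr rfl fun i _ => ?_
  simp [Finsupp.single_apply]

/-- The vector `∑_{|J| = k} a_{|I ∩ J|} V_J`, which is the projection `v_I`. -/
def projVec (n k : ℕ) (I : Finset (Fin n)) : WT n :=
  ∑ J ∈ powersetCard k univ, Finsupp.single J (aCoef n k #(I ∩ J))

/-- The vector `∑_{|K| = k - 1} b_{|I ∩ K|} V_K`, whose image under `f` is `v_I - V_I`. -/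
def coboundVec (n k : ℕ) (I : Finset (Fin n)) : WT n :=
  ∑ K ∈ powersetCard (k - 1) univ, Finsupp.single K (bCoef n k #(I ∩ K))

lemma sum_powersetCard_single_apply {n : ℕ} (k : ℕ) (c : Finset (Fin n) → ℂ)
    (J : Finset (Fin n)) :
    (∑ L ∈ powersetCard k univ, Finsupp.single L (c L) : WT n) J =
      if #J = k then c J else 0 := by
  simp [Finsupp.finsetSum_apply, Finsupp.single_apply]

lemma projVec_apply {n k : ℕ} (I J : Finset (Fin n)) :
    projVec n k I J = if #J = k then aCoef n k #(I ∩ J) else 0 :=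
  sum_powersetCard_single_apply k _ J

lemma coboundVec_apply {n k : ℕ} (I K : Finset (Fin n)) :
    coboundVec n k I K = if #K = k - 1 then bCoef n k #(I ∩ K) else 0 :=
  sum_powersetCard_single_apply (k - 1) _ K

lemma projVec_mem_weight (n k : ℕ) (I : Finset (Fin n)) : projVec n k I ∈ weight n k := by
  refine Submodule.sum_mem _ fun J hJ => ?_
  rw [← mul_one (aCoef n k _), ← smul_eq_mul, ← Finsupp.smul_single]
  exact Submodule.smul_mem _ _ (Submodule.subset_span ⟨J, (mem_powersetCard.1 hJ).2, rfl⟩)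

lemma aCoef_recurrence (r m d : ℕ) :
    ((d + 1 : ℕ) : ℂ) * aCoef (2 * (m + 1 + d) + r) (m + 1 + d) (m + 1) +
      ((r + m + 1 : ℕ) : ℂ) * aCoef (2 * (m + 1 + d) + r) (m + 1 + d) m = 0 := by
  have h1 : m + 1 + d - (m + 1) = d := by omega
  have h2 : m + 1 + d - m = d + 1 := by omega
  have h3 : 2 * (m + 1 + d) + r - 2 * (m + 1 + d) = r := by omega
  have h4 : r + (m + 1) = r + m + 1 := by omega
  simp only [aCoef, h1, h2, h3, h4, Nat.factorial_succ]
  push_cast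
  ring

lemma sum_compl_card_inter_insert {n : ℕ} (φ : ℕ → ℂ) (I K : Finset (Fin n)) :
    ∑ j ∈ Kᶜ, φ #(I ∩ insert j K) =
      #(I \ K) * φ (#(I ∩ K) + 1) + #(I ∪ K)ᶜ * φ #(I ∩ K) := by
  rw [← sum_filter_add_sum_filter_not Kᶜ (· ∈ I)]
  have h1 : Kᶜ.filter (· ∈ I) = I \ K := by ext; simp [and_comm]
  have h2 : Kᶜ.filter (· ∉ I) = (I ∪ K)ᶜ := by ext; simp [and_comm]
  rw [h1, h2, ← nsmul_eq_mul, ← nsmul_eq_mul, ← sum_const, ← sum_const]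
  congr 1
  · refine sum_congr rfl fun j hj => ?_
    rw [mem_sdiff] at hj
    rw [inter_insert_of_mem hj.1, card_insert_of_notMem (by simp [hj.2])]
  · refine sum_congr rfl fun j hj => ?_
    rw [inter_insert_of_notMem (by simp_all)]

lemma sum_card_inter_erase {n : ℕ} (φ : ℕ → ℂ) (I J : Finset (Fin n)) :
    ∑ j ∈ J, φ #(I ∩ J.erase j) =
      #(I ∩ J) * φ (#(I ∩ J) - 1) + #(J \ I) * φ #(I ∩ J) := by
  rw [← sum_filter_add_sum_filter_not J (· ∈ I)]
  have h1 : J.filter (· ∈ I) = I ∩ J := by ext; simp [and_comm]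
  have h2 : J.filter (· ∉ I) = J \ I := by ext; simp
  rw [h1, h2, ← nsmul_eq_mul, ← nsmul_eq_mul, ← sum_const, ← sum_const]
  congr 1
  · refine sum_congr rfl fun j hj => ?_
    rw [inter_erase, card_erase_of_mem hj]
  · refine sum_congr rfl fun j hj => ?_
    rw [inter_erase, erase_eq_of_notMem (by simp_all)]

lemma projVec_mem_sing {n k : ℕ} (hk : 1 ≤ k) (hn : 2 * k ≤ n) {I : Finset (Fin n)}
    (hI : #I = k) : projVec n k I ∈ sing n k := by
  refine ⟨projVec_mem_weight n k I, ?_⟩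
  rw [SetLike.mem_coe, LinearMap.mem_ker]
  ext K
  rw [opE_apply, Finsupp.zero_apply]
  by_cases hK : #K + 1 = k
  · have hsum : ∑ j ∈ Kᶜ, projVec n k I (insert j K) =
        ∑ j ∈ Kᶜ, aCoef n k #(I ∩ insert j K) := by
      refine sum_congr rfl fun j hj => ?_
      rw [projVec_apply, if_pos (by rw [card_insert_of_notMem (mem_compl.1 hj), hK])]
    rw [hsum, sum_compl_card_inter_insert (aCoef n k)]
    have e1 := card_sdiff_add_card_inter I K
    have e2 := card_union_add_card_inter I K
    have e3 := card_add_card_compl (I ∪ K)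
    have e4 := card_le_card (inter_subset_right : I ∩ K ⊆ K)
    rw [Fintype.card_fin] at e3
    generalize #(I ∩ K) = m at *
    obtain ⟨d, rfl⟩ : ∃ d, k = m + 1 + d := ⟨k - (m + 1), by omega⟩
    obtain ⟨r, rfl⟩ : ∃ r, n = 2 * (m + 1 + d) + r := ⟨n - 2 * (m + 1 + d), by omega⟩
    rw [show #(I \ K) = d + 1 by omega, show #(I ∪ K)ᶜ = r + m + 1 by omega]
    exact aCoef_recurrence r m d
  · refine sum_eq_zero fun j hj => ?_
    rw [projVec_apply, if_neg (by rwa [card_insert_of_notMem (mem_compl.1 hj)])]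

lemma bCoef_relation (r l d : ℕ) :
    (l : ℂ) * bCoef (2 * (l + (d + 1)) + r) (l + (d + 1)) (l - 1) +
      ((d + 1 : ℕ) : ℂ) * bCoef (2 * (l + (d + 1)) + r) (l + (d + 1)) l =
      aCoef (2 * (l + (d + 1)) + r) (l + (d + 1)) l := by
  have h3 : 2 * (l + (d + 1)) + r - 2 * (l + (d + 1)) = r := by omega
  rcases l with _ | l
  · simp [aCoef, bCoef, Nat.factorial_succ]
    ring
  · have h1 : l + 1 + (d + 1) - l = d + 2 := by omega
    have h2 : l + 1 + (d + 1) - (l + 1) = d + 1 := by omega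
    have h4 : (-1 : ℂ) ^ (l + 1 + (d + 1) + (l + 1)) = (-1) ^ (d + 1) := by
      rw [show l + 1 + (d + 1) + (l + 1) = (d + 1) + 2 * (l + 1) by ring, pow_add, pow_mul]
      simp
    simp only [aCoef, bCoef, h1, h2, h3, h4, Nat.add_sub_cancel, Nat.add_succ_sub_one,
      show r + (l + 1) = r + l + 1 by ring, Nat.factorial_succ]
    push_cast
    ring

lemma bCoef_relation_self (r k : ℕ) (hk : 1 ≤ k) :
    (k : ℂ) * bCoef (2 * k + r) k (k - 1) = aCoef (2 * k + r) k k - 1 := by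
  obtain ⟨k, rfl⟩ : ∃ l, k = l + 1 := ⟨k - 1, by omega⟩
  have h1 : 2 * (k + 1) + r - 2 * (k + 1) = r := by omega
  have h2 : 2 * (k + 1) + r - (k + 1) + 1 = r + k + 2 := by omega
  have h3 : (-1 : ℂ) ^ (k + 1 + (k + 1)) = 1 := by rw [← two_mul, pow_mul]; simp
  have hf : ((r + k + 1).factorial : ℂ) ≠ 0 := by exact_mod_cast Nat.factorial_ne_zero _
  have hs : (r : ℂ) + k + 1 + 1 ≠ 0 := by exact_mod_cast Nat.succ_ne_zero (r + k + 1)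
  simp only [aCoef, bCoef, h1, h2, h3, Nat.add_sub_cancel, Nat.sub_self, Nat.factorial_zero,
    show k + 1 - k = 1 by omega, show r + (k + 1) = r + k + 1 by ring,
    Nat.factorial_succ (r + k + 1)]
  push_cast
  field_simp
  ring

lemma opF_coboundVec {n k : ℕ} (hk : 1 ≤ k) (hn : 2 * k ≤ n) {I : Finset (Fin n)}
    (hI : #I = k) : opF n (coboundVec n k I) = projVec n k I - Finsupp.single I 1 := by
  ext J
  rw [opF_apply, Finsupp.sub_apply, projVec_apply]
  by_cases hJ : #J = k
  · have hsum : ∑ j ∈ J, coboundVec n k I (J.erase j) = ∑ j ∈ J, bCoef n k #(I ∩ J.erase j) := by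
      refine sum_congr rfl fun j hj => ?_
      rw [coboundVec_apply, if_pos (by rw [card_erase_of_mem hj, hJ])]
    rw [hsum, if_pos hJ, sum_card_inter_erase (bCoef n k)]
    obtain ⟨r, rfl⟩ : ∃ r, n = 2 * k + r := ⟨n - 2 * k, by omega⟩
    by_cases hIJ : I = J
    · subst hIJ
      simp [hI, bCoef_relation_self r k hk]
    · have e1 := card_sdiff_add_card_inter J I
      rw [inter_comm] at e1
      have hlt : #(I ∩ J) < k := by
        refine (card_lt_card ⟨inter_subset_left, fun h => hIJ ?_⟩).trans_eq hI
        exact eq_of_subset_of_card_le (h.trans inter_subset_right) (by omega)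
      rw [Finsupp.single_eq_of_ne' hIJ, sub_zero]
      generalize #(I ∩ J) = l at *
      obtain ⟨d, rfl⟩ : ∃ d, k = l + (d + 1) := ⟨k - (l + 1), by omega⟩
      rw [show #(J \ I) = d + 1 by omega]
      exact bCoef_relation r l d
  · rw [if_neg hJ, Finsupp.single_eq_of_ne (by rintro rfl; exact hJ hI), sub_zero]
    refine sum_eq_zero fun j hj => ?_
    rw [coboundVec_apply, if_neg]
    rw [card_erase_of_mem hj]
    have := card_pos.2 ⟨j, hj⟩
    omega

lemma shap_projection {n k : ℕ} (hk : 1 ≤ k) (hn : 2 * k ≤ n) (π : WT n →ₗ[ℂ] WT n)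
    (hrange : ∀ x ∈ weight n k, π x ∈ sing n k)
    (horth : ∀ x ∈ weight n k, ∀ s ∈ sing n k, shap (x - π x) s = 0)
    {I J : Finset (Fin n)} (hI : #I = k) (hJ : #J = k) :
    shap (π (Finsupp.single I 1)) (π (Finsupp.single J 1)) = aCoef n k #(I ∩ J) := by
  have hwI : (Finsupp.single I 1 : WT n) ∈ weight n k := Submodule.subset_span ⟨I, hI, rfl⟩
  have hwJ : (Finsupp.single J 1 : WT n) ∈ weight n k := Submodule.subset_span ⟨J, hJ, rfl⟩
  have hsJ := hrange _ hwJ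
  have h1 := horth _ hwI _ hsJ
  have h2 := horth _ hwJ _ (projVec_mem_sing hk hn hI)
  have h3 : shap (projVec n k I - Finsupp.single I 1) (π (Finsupp.single J 1)) = 0 := by
    rw [← opF_coboundVec hk hn hI, shap_opF, LinearMap.mem_ker.1 hsJ.2]
    simp [shap_eq_sum]
  rw [shap_sub_left] at h1 h2 h3
  rw [shap_single_left, projVec_apply, if_pos hJ] at h2
  rw [shap_comm (projVec n k I)] at h3
  linear_combination -h1 - h3 - h2

open MvPolynomial in
lemma foldl_pderiv_sum {n k : ℕ} {ι : Type*} (l : List (Fin k)) (g : Fin k → Fin n)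
    (s : Finset ι) (p : ι → PZ n k) :
    l.foldl (fun q j => pderiv (g j, j) q) (∑ a ∈ s, p a) =
      ∑ a ∈ s, l.foldl (fun q j => pderiv (g j, j) q) (p a) := by
  induction l generalizing p with
  | nil => rfl
  | cons j l ih => simp only [List.foldl_cons, map_sum, ih]

open MvPolynomial in
lemma foldl_pderiv_C_mul {n k : ℕ} (l : List (Fin k)) (g : Fin k → Fin n) (c : ℂ)
    (p : PZ n k) :
    l.foldl (fun q j => pderiv (g j, j) q) (C c * p) =
      C c * l.foldl (fun q j => pderiv (g j, j) q) p := by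
  induction l generalizing p with
  | nil => rfl
  | cons j l ih => simp only [List.foldl_cons, pderiv_C_mul, ih]

lemma derSeq_sum {n k : ℕ} {ι : Type*} (g : Fin k → Fin n) (s : Finset ι) (p : ι → PZ n k) :
    derSeq g (∑ a ∈ s, p a) = ∑ a ∈ s, derSeq g (p a) :=
  foldl_pderiv_sum _ g s p

lemma derSeq_C_mul {n k : ℕ} (g : Fin k → Fin n) (c : ℂ) (p : PZ n k) :
    derSeq g (MvPolynomial.C c * p) = MvPolynomial.C c * derSeq g p :=
  foldl_pderiv_C_mul _ g c p

open MvPolynomial in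
lemma foldl_pderiv_prod {n k : ℕ} (g : Fin k → Fin n) (F F' : Fin k → PZ n k)
    (hF : ∀ j, pderiv (g j, j) (F j) = F' j)
    (hne : ∀ i j, i ≠ j → pderiv (g j, j) (F i) = 0)
    (hne' : ∀ i j, i ≠ j → pderiv (g j, j) (F' i) = 0)
    (l : List (Fin k)) (hl : l.Nodup) (t : Finset (Fin k)) (ht : ∀ j ∈ l, j ∉ t) :
    l.foldl (fun q j => pderiv (g j, j) q) (∏ i, if i ∈ t then F' i else F i) =
      ∏ i, if i ∈ t ∨ i ∈ l then F' i else F i := by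
  induction l generalizing t with
  | nil => simp
  | cons j l ih =>
    rw [List.nodup_cons] at hl
    have hjt : j ∉ t := ht j List.mem_cons_self
    have hstep : pderiv (g j, j) (∏ i, if i ∈ t then F' i else F i) =
        ∏ i, if i ∈ insert j t then F' i else F i := by
      rw [← mul_prod_erase univ _ (mem_univ j), ← mul_prod_erase univ _ (mem_univ j),
        Derivation.leibniz, if_neg hjt, if_pos (mem_insert_self j t), hF]
      have hzero : pderiv (g j, j) (∏ i ∈ univ.erase j, if i ∈ t then F' i else F i) = 0 := by
        refine prod_induction _ (fun p => pderiv (g j, j) p = 0) ?_ (by simp) ?_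
        · intro a b ha hb
          simp [Derivation.leibniz, ha, hb]
        · intro i hi
          split_ifs
          · exact hne' i j (ne_of_mem_erase hi)
          · exact hne i j (ne_of_mem_erase hi)
      rw [hzero, smul_zero, zero_add, smul_eq_mul, mul_comm]
      congr 1
      refine prod_congr rfl fun i hi => ?_
      simp [ne_of_mem_erase hi]
    rw [List.foldl_cons, hstep, ih hl.2 (insert j t)]
    · refine prod_congr rfl fun i _ => ?_
      simp only [mem_insert, List.mem_cons, or_assoc, or_left_comm]
    · intro i hi
      rw [mem_insert, not_or]
      exact ⟨fun h => hl.1 (h ▸ hi), ht i (List.mem_cons_of_mem _ hi)⟩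

open MvPolynomial in
lemma derSeq_prod {n k : ℕ} (g : Fin k → Fin n) (F F' : Fin k → PZ n k)
    (hF : ∀ j, pderiv (g j, j) (F j) = F' j)
    (hne : ∀ i j, i ≠ j → pderiv (g j, j) (F i) = 0)
    (hne' : ∀ i j, i ≠ j → pderiv (g j, j) (F' i) = 0) :
    derSeq g (∏ i, F i) = ∏ i, F' i := by
  simpa [derSeq] using
    foldl_pderiv_prod g F F' hF hne hne' (List.finRange k) (List.nodup_finRange k) ∅ (by simp)

/-- The sign `∂(z_p - z_q)/∂z_x`. -/
def incidence {n : ℕ} (x : Fin n) (a : Fin n × Fin n) : ℂ :=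
  (if x = a.1 then 1 else 0) - (if x = a.2 then 1 else 0)

open MvPolynomial in
lemma pderiv_X_sub_X {n k : ℕ} (x : Fin n) (a : Fin n × Fin n) (i j : Fin k) :
    pderiv (x, j) (X (a.1, i) - X (a.2, i) : PZ n k) =
      if i = j then C (incidence x a) else 0 := by
  have hX (y : Fin n) : pderiv (x, j) (X (y, i) : PZ n k) =
      if i = j then C (if x = y then 1 else 0) else 0 := by
    by_cases h : (y, i) = (x, j)
    · obtain ⟨rfl, rfl⟩ := Prod.mk.inj h
      simp
    · rw [pderiv_X_of_ne h]
      split_ifs with h1 h2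
      · exact absurd (by rw [h1, h2]) h
      · simp
      · rfl
  rw [map_sub, hX, hX]
  by_cases h : i = j
  · rw [if_pos h, if_pos h, if_pos h, ← map_sub, incidence]
  · rw [if_neg h, if_neg h, if_neg h, sub_zero]

open MvPolynomial in
lemma derSeq_derSeq_prod_sq {n k : ℕ} (g h : Fin k → Fin n) (α : Fin k → Fin n × Fin n) :
    derSeq g (derSeq h (∏ i, (X ((α i).1, i) - X ((α i).2, i) : PZ n k) ^ 2)) =
      C (2 ^ k * ∏ i, incidence (g i) (α i) * incidence (h i) (α i)) := by
  rw [derSeq_prod h _ (fun i => C (2 * incidence (h i) (α i)) * (X ((α i).1, i) - X ((α i).2, i))),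
    derSeq_prod g _ (fun i => C (2 * incidence (h i) (α i)) * C (incidence (g i) (α i)))]
  · have hpow : (2 : ℂ) ^ k = ∏ _i : Fin k, 2 := by simp
    rw [hpow, ← prod_mul_distrib, map_prod]
    refine prod_congr rfl fun i _ => ?_
    rw [← map_mul]
    congr 1
    ring
  · intro j
    rw [pderiv_C_mul, pderiv_X_sub_X, if_pos rfl]
  · intro i j hij
    rw [pderiv_C_mul, pderiv_X_sub_X, if_neg hij, mul_zero]
  · intro i j _
    rw [← map_mul, pderiv_C]
  · intro j
    rw [pderiv_pow, pderiv_X_sub_X, if_pos rfl, map_mul,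
      show (C 2 : PZ n k) = 2 from map_ofNat C 2]
    push_cast
    ring
  · intro i j hij
    rw [pderiv_pow, pderiv_X_sub_X, if_neg hij, mul_zero]
  · intro i j hij
    rw [pderiv_C_mul, pderiv_X_sub_X, if_neg hij, mul_zero]

/-- The bijections from `{1,…,k}` onto the `k`-element set `I`. -/
def enumerations {n : ℕ} (k : ℕ) (I : Finset (Fin n)) : Finset (Fin k → Fin n) :=
  univ.filter fun g => Function.Injective g ∧ ∀ j, g j ∈ I

open MvPolynomial in
lemma pderI_pderI_Ppoly {n k : ℕ} (I J : Finset (Fin n)) :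
    pderI I (pderI J (Ppoly n k)) = C (c1 n k * 2 ^ k *
      ∑ g ∈ enumerations k I, ∑ h ∈ enumerations k J, ∑ α ∈ pairSeqs n k,
        ∏ i, incidence (g i) (α i) * incidence (h i) (α i)) := by
  simp only [pderI, Ppoly, derSeq_C_mul, derSeq_sum, derSeq_derSeq_prod_sq]
  simp only [← map_sum, ← map_mul, ← mul_sum, mul_assoc, enumerations]

lemma card_injective_piecewise {n k : ℕ} (P : Fin k → Prop) [DecidablePred P]
    {A B : Finset (Fin n)} (hAB : Disjoint A B) :
    #(univ.filter fun q : Fin k → Fin n =>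
      Function.Injective q ∧ ∀ i, (P i → q i ∈ A) ∧ (¬ P i → q i ∈ B)) =
      (#A).descFactorial #(univ.filter P) * (#B).descFactorial #(univ.filter fun i => ¬ P i) := by
  rw [Finset.disjoint_left] at hAB
  rw [← Fintype.card_coe A, ← Fintype.card_coe B, ← Fintype.card_subtype P,
    ← Fintype.card_subtype fun i => ¬ P i, ← Fintype.card_embedding_eq, ← Fintype.card_embedding_eq,
    ← Fintype.card_prod, ← Fintype.card_subtype]
  refine Fintype.card_congr
    { toFun := fun q =>
        (⟨fun i => ⟨q.1 i, (q.2.2 i).1 i.2⟩, fun i j h => Subtype.ext (q.2.1 (by simpa using h))⟩,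
          ⟨fun i => ⟨q.1 i, (q.2.2 i).2 i.2⟩,
            fun i j h => Subtype.ext (q.2.1 (by simpa using h))⟩)
      invFun := fun e =>
        ⟨fun i => if h : P i then (e.1 ⟨i, h⟩ : Fin n) else e.2 ⟨i, h⟩, ?_, ?_⟩
      left_inv := ?_
      right_inv := ?_ }
  · intro i j hij
    have h1 := fun x => (e.1 x).2
    have h2 := fun x => (e.2 x).2
    by_cases hi : P i <;> by_cases hj : P j <;> simp only [hi, hj, dite_true, dite_false] at hij
    · simpa using e.1.injective (Subtype.ext hij)
    · exact absurd (h2 _) (hij ▸ hAB (h1 _))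
    · exact absurd (h2 _) (hij ▸ hAB (h1 _))
    · simpa using e.2.injective (Subtype.ext hij)
  · intro i
    refine ⟨fun h => ?_, fun h => ?_⟩
    · simp [h]
    · simp [h]
  · intro q
    ext i
    by_cases h : P i <;> simp only [h, dite_true, dite_false] <;> rfl
  · rintro ⟨e₁, e₂⟩
    ext i
    · simp [i.2]
    · simp [i.2]

lemma card_enumerations {n k : ℕ} {I : Finset (Fin n)} (hI : #I = k) :
    #(enumerations k I) = k.factorial := by
  have h := card_injective_piecewise (k := k) (fun _ => True) (disjoint_empty_right I)
  simpa [hI, Nat.descFactorial_self, enumerations] using h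

lemma exists_eq_of_mem_enumerations {n k : ℕ} {I : Finset (Fin n)} (hI : #I = k)
    {g : Fin k → Fin n} (hg : g ∈ enumerations k I) {x : Fin n} (hx : x ∈ I) :
    ∃ j, g j = x := by
  obtain ⟨hinj, hmem⟩ := (mem_filter.1 hg).2
  have himg : univ.image g = I := by
    refine eq_of_subset_of_card_le (fun y hy => ?_) ?_
    · obtain ⟨j, _, rfl⟩ := mem_image.1 hy
      exact hmem j
    · rw [card_image_of_injective _ hinj, hI, card_univ, Fintype.card_fin]
  rw [← himg] at hx
  simpa using hx

/-- The pairs `(h, α)` for which `g i` and `h i` both belong to the `i`-th pair of `α`. -/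
def compatible {n k : ℕ} (J : Finset (Fin n)) (g : Fin k → Fin n) :
    Finset ((Fin k → Fin n) × (Fin k → Fin n × Fin n)) :=
  (enumerations k J ×ˢ pairSeqs n k).filter fun x =>
    ∀ i, (g i = (x.2 i).1 ∨ g i = (x.2 i).2) ∧ (x.1 i = (x.2 i).1 ∨ x.1 i = (x.2 i).2)

/-- The choices of a partner `q i` of each `g i` that come from a compatible `(h, α)`. -/
def partners {n k : ℕ} (I J : Finset (Fin n)) (g : Fin k → Fin n) : Finset (Fin k → Fin n) :=
  univ.filter fun q => Function.Injective q ∧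
    ∀ i, (g i ∈ J → q i ∈ (I ∪ J)ᶜ) ∧ (¬ g i ∈ J → q i ∈ J \ I)

lemma eq_of_mem_pairSeqs {n k : ℕ} {α : Fin k → Fin n × Fin n} (hα : α ∈ pairSeqs n k)
    {i j : Fin k} {x : Fin n} (hi : x = (α i).1 ∨ x = (α i).2)
    (hj : x = (α j).1 ∨ x = (α j).2) : i = j := by
  by_contra hne
  have hd := (mem_filter.1 hα).2.2 i j hne
  have hxi : x ∈ ({(α i).1, (α i).2} : Finset (Fin n)) := by simpa using hi
  exact Finset.disjoint_left.1 hd hxi (by simpa using hj)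

lemma eq_of_mem_compatible {n k : ℕ} {J : Finset (Fin n)} (hJ : #J = k) {g h : Fin k → Fin n}
    {α : Fin k → Fin n × Fin n} (hx : (h, α) ∈ compatible J g) {i : Fin k} (hi : g i ∈ J) :
    h i = g i := by
  obtain ⟨hmem, hc⟩ := mem_filter.1 hx
  obtain ⟨hh, hα⟩ := mem_product.1 hmem
  obtain ⟨j, hj⟩ := exists_eq_of_mem_enumerations hJ hh hi
  have hij : i = j := eq_of_mem_pairSeqs hα (hc i).1 (hj ▸ (hc j).2)
  subst hij
  exact hj

lemma prod_incidence_of_mem_compatible {n k : ℕ} {J : Finset (Fin n)} (hJ : #J = k)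
    {g h : Fin k → Fin n} {α : Fin k → Fin n × Fin n} (hx : (h, α) ∈ compatible J g) :
    ∏ i, incidence (g i) (α i) * incidence (h i) (α i) = (-1) ^ #(univ.filter (g · ∉ J)) := by
  obtain ⟨hmem, hc⟩ := mem_filter.1 hx
  obtain ⟨hh, hα⟩ := mem_product.1 hmem
  have hhJ := (mem_filter.1 hh).2.2
  rw [← prod_const, prod_filter]
  refine prod_congr rfl fun i _ => ?_
  have hlt := ((mem_filter.1 hα).2.1 i).ne
  have hc' := hc i
  have hgJ : h i = g i ↔ g i ∈ J :=
    ⟨fun hi => hi ▸ hhJ i, eq_of_mem_compatible hJ hx⟩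
  simp only [← hgJ, incidence]
  rcases hc'.1 with h1 | h1 <;> rcases hc'.2 with h2 | h2 <;> simp_all [hlt.symm]

lemma prod_incidence_eq_zero {n k : ℕ} {J : Finset (Fin n)} {g h : Fin k → Fin n}
    {α : Fin k → Fin n × Fin n} (hmem : (h, α) ∈ enumerations k J ×ˢ pairSeqs n k)
    (hx : (h, α) ∉ compatible J g) :
    ∏ i, incidence (g i) (α i) * incidence (h i) (α i) = 0 := by
  have hex : ∃ i, ¬ ((g i = (α i).1 ∨ g i = (α i).2) ∧ (h i = (α i).1 ∨ h i = (α i).2)) := by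
    by_contra! hall
    exact hx (mem_filter.2 ⟨hmem, hall⟩)
  obtain ⟨i, hi⟩ := hex
  refine prod_eq_zero (mem_univ i) ?_
  rw [not_and_or, not_or, not_or] at hi
  rcases hi with hi | hi <;> simp [incidence, hi.1, hi.2]

lemma card_compatible {n k : ℕ} {I J : Finset (Fin n)} (hI : #I = k) (hJ : #J = k)
    {g : Fin k → Fin n} (hg : g ∈ enumerations k I) :
    #(compatible J g) = #(partners I J g) := by
  obtain ⟨hginj, hgI⟩ := (mem_filter.1 hg).2
  refine card_bij'
    (fun x _ i => if g i = (x.2 i).1 then (x.2 i).2 else (x.2 i).1)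
    (fun q _ => (fun i => if g i ∈ J then g i else q i,
      fun i => (min (g i) (q i), max (g i) (q i)))) ?_ ?_ ?_ ?_
  · rintro ⟨h, α⟩ hx
    obtain ⟨hmem, hc⟩ := mem_filter.1 hx
    obtain ⟨hh, hα⟩ := mem_product.1 hmem
    have hhJ := (mem_filter.1 hh).2.2
    have hlt := (mem_filter.1 hα).2.1
    dsimp only at hc ⊢
    set q : Fin k → Fin n := fun i => if g i = (α i).1 then (α i).2 else (α i).1 with hq
    have hqα (i) : q i = (α i).1 ∨ q i = (α i).2 := by
      simp only [hq]; split_ifs <;> simp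
    have hqg (i) : q i ≠ g i := by
      have := (hlt i).ne
      have := (hc i).1
      simp only [hq]; grind
    have hgq (i) (x : Fin n) (hx : x = (α i).1 ∨ x = (α i).2) : x = g i ∨ x = q i := by
      have := (hc i).1
      simp only [hq]; grind
    have hqI (i) : q i ∉ I := by
      intro hi
      obtain ⟨j, hj⟩ := exists_eq_of_mem_enumerations hI hg hi
      obtain rfl : i = j := eq_of_mem_pairSeqs hα (hqα i) (hj ▸ (hc j).1)
      exact hqg i hj.symm
    refine mem_filter.2 ⟨mem_univ _, fun i j hij => ?_, fun i => ⟨fun hi => ?_, fun hi => ?_⟩⟩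
    · exact eq_of_mem_pairSeqs hα (hqα i) (hij ▸ hqα j)
    · rw [mem_compl, mem_union, not_or]
      refine ⟨hqI i, fun hiJ => ?_⟩
      obtain ⟨j, hj⟩ := exists_eq_of_mem_enumerations hJ hh hiJ
      obtain rfl : i = j := eq_of_mem_pairSeqs hα (hqα i) (hj ▸ (hc j).2)
      exact hqg i (hj.symm.trans (eq_of_mem_compatible hJ hx hi))
    · refine mem_sdiff.2 ⟨?_, hqI i⟩
      rcases hgq i (h i) (hc i).2 with h1 | h1
      · exact absurd (h1 ▸ hhJ i) hi
      · exact h1 ▸ hhJ i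
  · intro q hq
    obtain ⟨hqinj, hqm⟩ := (mem_filter.1 hq).2
    have hqI (i) : q i ∉ I := by
      by_cases hi : g i ∈ J
      · have := (hqm i).1 hi
        simp_all
      · exact (mem_sdiff.1 ((hqm i).2 hi)).2
    have hgq (i j) : g i ≠ q j := fun h => hqI j (h ▸ hgI i)
    refine mem_filter.2 ⟨mem_product.2 ⟨mem_filter.2 ⟨mem_univ _, ?_, ?_⟩,
      mem_filter.2 ⟨mem_univ _, ?_, ?_⟩⟩, ?_⟩
    · intro i j hij
      have := @hginj i j
      have := @hqinj i j
      have := hgq i j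
      have := hgq j i
      grind
    · intro i
      have := (hqm i).2
      grind
    · intro i
      exact min_lt_max.2 (hgq i i)
    · intro i j hij
      have hp (l) : ({min (g l) (q l), max (g l) (q l)} : Finset (Fin n)) = {g l, q l} := by
        rcases le_total (g l) (q l) with h | h
        · simp [h]
        · simp [h, pair_comm]
      have h1 := hginj.ne hij
      have h2 := hqinj.ne hij
      have h3 := hgq i j
      have h4 := hgq j i
      simp only [hp]
      simp [h1.symm, h2.symm, h4, h3.symm]
    · intro i
      dsimp only
      grind
  · rintro ⟨h, α⟩ hx
    obtain ⟨hmem, hc⟩ := mem_filter.1 hx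
    obtain ⟨hh, hα⟩ := mem_product.1 hmem
    have hhJ := (mem_filter.1 hh).2.2
    have hlt := (mem_filter.1 hα).2.1
    dsimp only at hc ⊢
    refine Prod.ext (funext fun i => ?_) (funext fun i => ?_)
    · have h1 := @eq_of_mem_compatible _ _ _ hJ _ _ _ hx i
      have h2 := hhJ i
      have h3 := hc i
      grind
    · have h1 := hlt i
      have h2 := (hc i).1
      refine Prod.ext ?_ ?_ <;> dsimp only <;> grind
  · intro q hq
    funext i
    dsimp only
    grind

lemma card_filter_enumeration {n k : ℕ} {I : Finset (Fin n)} (hI : #I = k) {g : Fin k → Fin n}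
    (hg : g ∈ enumerations k I) (P : Fin n → Prop) [DecidablePred P] :
    #(univ.filter fun i => P (g i)) = #(I.filter P) := by
  obtain ⟨hginj, hgI⟩ := (mem_filter.1 hg).2
  rw [← card_image_of_injective _ hginj]
  congr 1
  ext x
  simp only [mem_image, mem_filter, mem_univ, true_and]
  constructor
  · rintro ⟨i, hi, rfl⟩
    exact ⟨hgI i, hi⟩
  · rintro ⟨hx, hP⟩
    obtain ⟨j, rfl⟩ := exists_eq_of_mem_enumerations hI hg hx
    exact ⟨j, hP, rfl⟩

lemma card_partners {n k : ℕ} {I J : Finset (Fin n)} (hI : #I = k) {g : Fin k → Fin n}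
    (hg : g ∈ enumerations k I) :
    #(partners I J g) =
      (#(I ∪ J)ᶜ).descFactorial #(I ∩ J) * (#(J \ I)).descFactorial #(I \ J) := by
  have hdisj : Disjoint (I ∪ J)ᶜ (J \ I) := by
    rw [Finset.disjoint_left]
    intro x hx
    simp_all
  rw [partners, card_injective_piecewise (fun i => g i ∈ J) hdisj,
    card_filter_enumeration hI hg (· ∈ J), card_filter_enumeration hI hg (· ∉ J),
    filter_mem_eq_inter, filter_notMem_eq_sdiff]

lemma sum_prod_incidence {n k : ℕ} {I J : Finset (Fin n)} (hI : #I = k) (hJ : #J = k) :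
    ∑ g ∈ enumerations k I, ∑ h ∈ enumerations k J, ∑ α ∈ pairSeqs n k,
        ∏ i, incidence (g i) (α i) * incidence (h i) (α i) =
      k.factorial * (((#(I ∪ J)ᶜ).descFactorial #(I ∩ J) : ℕ) *
        ((#(J \ I)).descFactorial #(I \ J) : ℕ) * (-1) ^ #(I \ J)) := by
  rw [← card_enumerations hI, ← nsmul_eq_mul, ← sum_const]
  refine sum_congr rfl fun g hg => ?_
  rw [← sum_product', ← sum_subset (s₁ := compatible J g) (filter_subset _ _)
    fun x hmem hx => prod_incidence_eq_zero hmem hx,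
    sum_congr rfl fun x hx => prod_incidence_of_mem_compatible hJ hx, sum_const,
    nsmul_eq_mul, card_compatible hI hJ hg, card_partners hI hg,
    card_filter_enumeration hI hg (· ∉ J), filter_notMem_eq_sdiff]
  push_cast
  rfl

lemma c1_mul_sum_prod_incidence {n k : ℕ} (hn : 2 * k ≤ n) {I J : Finset (Fin n)}
    (hI : #I = k) (hJ : #J = k) :
    c1 n k * 2 ^ k * ∑ g ∈ enumerations k I, ∑ h ∈ enumerations k J, ∑ α ∈ pairSeqs n k,
        ∏ i, incidence (g i) (α i) * incidence (h i) (α i) = aCoef n k #(I ∩ J) := by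
  rw [sum_prod_incidence hI hJ]
  have e1 := card_sdiff_add_card_inter I J
  have e2 := card_sdiff_add_card_inter J I
  have e3 := card_union_add_card_inter I J
  have e4 := card_add_card_compl (I ∪ J)
  rw [inter_comm] at e2
  rw [Fintype.card_fin] at e4
  generalize #(I ∩ J) = l at *
  obtain ⟨d, rfl⟩ : ∃ d, k = l + d := ⟨k - l, by omega⟩
  obtain ⟨r, rfl⟩ : ∃ r, n = 2 * (l + d) + r := ⟨n - 2 * (l + d), by omega⟩
  rw [show #(I \ J) = d by omega, show #(J \ I) = d by omega,
    show #(I ∪ J)ᶜ = r + l by omega, Nat.descFactorial_self]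
  have hdesc : (r.factorial : ℂ) * ((r + l).descFactorial l : ℕ) = ((r + l).factorial : ℂ) := by
    have h := Nat.factorial_mul_descFactorial (Nat.le_add_left l r)
    rw [Nat.add_sub_cancel] at h
    exact_mod_cast h
  have hsign : (-1 : ℂ) ^ (l + d + l) = (-1) ^ d := by
    rw [show l + d + l = d + 2 * l by ring, pow_add, pow_mul]
    simp
  have hk : ((l + d).factorial : ℂ) ≠ 0 := by exact_mod_cast Nat.factorial_ne_zero _
  have hN : ((2 * (l + d) + r - (l + d) + 1).factorial : ℂ) ≠ 0 := by
    exact_mod_cast Nat.factorial_ne_zero _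
  simp only [c1, aCoef, hsign, Nat.add_sub_cancel_left, ← hdesc, Nat.factorial_succ r]
  field_simp
  push_cast
  ring

/-- for `k`-element subsets `I, J`, `∂_I ∂_J P` is the constant
polynomial with value `(v_I, v_J)`, and this value is `a_{|I∩J|}`. -/
theorem stmt12 (n k : ℕ) (hk : 1 ≤ k) (hn : 2 * k ≤ n)
    (π : WT n →ₗ[ℂ] WT n)
    (hrange : ∀ x ∈ weight n k, π x ∈ sing n k)
    (hfix : ∀ x ∈ sing n k, π x = x)
    (horth : ∀ x ∈ weight n k, ∀ s ∈ sing n k, shap (x - π x) s = 0)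
    (I J : Finset (Fin n)) (hI : I.card = k) (hJ : J.card = k) :
    pderI I (pderI J (Ppoly n k)) =
      MvPolynomial.C (shap (π (Finsupp.single I 1)) (π (Finsupp.single J 1))) ∧
    shap (π (Finsupp.single I 1)) (π (Finsupp.single J 1)) =
      aCoef n k (I ∩ J).card := by
  have hshap := shap_projection hk hn π hrange horth hI hJ
  refine ⟨?_, hshap⟩
  rw [hshap, pderI_pderI_Ppoly, c1_mul_sum_prod_incidence hn hI hJ]
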